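/- arXiv:0910.4511 — 2 statements merged into one kernel-verified Lean document; each statement's English description precedes it below -/
import Mathlib

section
/- For every weakly C(4) finite monoid presentation ⟨A | R⟩, the word problem is decidable: the relation {(u, v) ∈ A* × A* : u ≡ v} is a decidable relation on pairs of words. -/
open List

/-- A *relation word* is a word occurring as one side of some relation in `R`. -/
def RelWord {A : Type*} (R : Finset (List A × List A)) (w : List A) : Prop :=
  ∃ p ∈ R, w = p.1 ∨ w = p.2

/-- One elementary rewriting step using a defining relation (in either direction). -/
def OneStep {A : Type*} (R : Finset (List A × List A)) (u v : List A) : Prop :=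
  ∃ l r x y, ((x, y) ∈ R ∨ (y, x) ∈ R) ∧ u = l ++ x ++ r ∧ v = l ++ y ++ r

/-- `u ≡ v`: the congruence on the free monoid `A*` generated by the relations `R`. -/
def MEquiv {A : Type*} (R : Finset (List A × List A)) : List A → List A → Prop :=
  Relation.ReflTransGen (OneStep R)

/-- A *piece*: a word occurring as a factor of two distinct relation words, or in two
different (possibly overlapping) positions within one relation word.  The empty word
is a piece. -/
def Piece {A : Type*} (R : Finset (List A × List A)) (p : List A) : Prop :=
  p = [] ∨ ∃ r₁ r₂ a₁ b₁ a₂ b₂, RelWord R r₁ ∧ RelWord R r₂ ∧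
    r₁ = a₁ ++ p ++ b₁ ∧ r₂ = a₂ ++ p ++ b₂ ∧ (r₁ ≠ r₂ ∨ a₁ ≠ a₂)

/-- Weakly `C(n)`: no relation word is a product of strictly fewer than `n` pieces. -/
def WeaklyC {A : Type*} (R : Finset (List A × List A)) (n : ℕ) : Prop :=
  ∀ w, RelWord R w → ∀ L : List (List A), (∀ p ∈ L, Piece R p) → w = L.flatten →
    n ≤ L.length

/-- `X` is the maximal (longest) prefix of `r` which is a piece. -/
def MaxPiecePrefix {A : Type*} (R : Finset (List A × List A)) (r X : List A) : Prop :=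
  X <+: r ∧ Piece R X ∧ ∀ p, p <+: r → Piece R p → p.length ≤ X.length

/-- `Z` is the maximal (longest) suffix of `r` which is a piece. -/
def MaxPieceSuffix {A : Type*} (R : Finset (List A × List A)) (r Z : List A) : Prop :=
  Z <:+ r ∧ Piece R Z ∧ ∀ s, s <:+ r → Piece R s → s.length ≤ Z.length

/-- `X ++ Y ++ Z` is a relation word with maximal piece prefix `X`, middle word `Y`
and maximal piece suffix `Z`. -/
def RelDecomp {A : Type*} (R : Finset (List A × List A)) (X Y Z : List A) : Prop :=
  RelWord R (X ++ Y ++ Z) ∧ MaxPiecePrefix R (X ++ Y ++ Z) X ∧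
    MaxPieceSuffix R (X ++ Y ++ Z) Z

/-- `q` is a relation prefix of `u`: a prefix of the form `a ++ X ++ Y` where `X`, `Y`
are the maximal piece prefix and middle word of some relation word `X ++ Y ++ Z`. -/
def RelPrefix {A : Type*} (R : Finset (List A × List A)) (u q : List A) : Prop :=
  q <+: u ∧ ∃ a X Y Z, q = a ++ X ++ Y ∧ RelDecomp R X Y Z

/-- `a ++ X ++ Y` is an overlap prefix of `u`, with final maximal piece prefix `X` and
middle word `Y`, i.e. it admits a factorisation `b X₁ Y₁' ⋯ X_{n-1} Y_{n-1}' X_n Y_n`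
with `X = X_n`, `Y = Y_n`, no factor `X₀ Y₀` beginning strictly before the end of `b`,
each `X_i Y_i Z_i` a relation word factored into maximal piece prefix, middle word and
maximal piece suffix, and each `Y_i'` (`i < n`) a proper non-empty prefix of `Y_i`. -/
def OPrefix {A : Type*} (R : Finset (List A × List A)) (u a X Y : List A) : Prop :=
  (a ++ X ++ Y) <+: u ∧
  ∃ (b : List A) (n : ℕ) (Xs Ys Zs Ys' : ℕ → List A),
    1 ≤ n ∧ Xs (n - 1) = X ∧ Ys (n - 1) = Y ∧
    a = b ++ ((List.range (n - 1)).map fun i => Xs i ++ Ys' i).flatten ∧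
    (∀ i < n, RelDecomp R (Xs i) (Ys i) (Zs i)) ∧
    (∀ i < n - 1, Ys' i ≠ [] ∧ Ys' i <+: Ys i ∧ Ys' i ≠ Ys i) ∧
    ¬ ∃ c d X₀ Y₀ Z₀, RelDecomp R X₀ Y₀ Z₀ ∧
        a ++ X ++ Y = c ++ X₀ ++ Y₀ ++ d ∧ c.length < b.length

/-- The relation prefix `a ++ X ++ Y` of `u` is *clean*: `u` has no prefix
`a ++ X ++ Y₀ ++ X₁ ++ Y₁` with `Y₀` a proper non-empty prefix of `Y` and `X₁`, `Y₁`
the maximal piece prefix and middle word of some relation word. -/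
def CleanAt {A : Type*} (R : Finset (List A × List A)) (u a X Y : List A) : Prop :=
  ¬ ∃ Y₀ X₁ Y₁ Z₁, RelDecomp R X₁ Y₁ Z₁ ∧ Y₀ ≠ [] ∧ Y₀ <+: Y ∧ Y₀ ≠ Y ∧
      (a ++ X ++ Y₀ ++ X₁ ++ Y₁) <+: u

/-- `a ++ X ++ Y` is a clean overlap prefix of `u`, where `X ++ Y ++ Z` is a relation
word with maximal piece prefix `X`, middle word `Y` and maximal piece suffix `Z`. -/
def CleanOverlapPrefix {A : Type*} (R : Finset (List A × List A))
    (u a X Y Z : List A) : Prop :=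
  RelDecomp R X Y Z ∧ OPrefix R u a X Y ∧ CleanAt R u a X Y

/-- `r'` is a complement of the relation word `r`: there is a chain of relation words
from `r` to `r'` each consecutive pair of which forms a relation (in some order). -/
def RelComplement {A : Type*} (R : Finset (List A × List A)) (r r' : List A) : Prop :=
  RelWord R r ∧ Relation.ReflTransGen (fun s t => (s, t) ∈ R ∨ (t, s) ∈ R) r r'

/-- `u` is `p`-active: `p ++ u` has a relation prefix `a ++ X ++ Y` with `|a| < |p|`. -/
def PActive {A : Type*} (R : Finset (List A × List A)) (p u : List A) : Prop :=
  ∃ a X Y Z, RelDecomp R X Y Z ∧ (a ++ X ++ Y) <+: (p ++ u) ∧ a.length < p.length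

/-- `p` is a possible prefix of `u`: `p ++ w ≡ u` for some word `w`. -/
def PossPrefix {A : Type*} (R : Finset (List A × List A)) (p u : List A) : Prop :=
  ∃ w, MEquiv R (p ++ w) u

section Covering

variable {A : Type*} {R : Finset (List A × List A)}

theorem RelWord.of_mem_or {x y : List A} (h : (x, y) ∈ R ∨ (y, x) ∈ R) :
    RelWord R x ∧ RelWord R y := by
  rcases h with h | h
  · exact ⟨⟨_, h, Or.inl rfl⟩, ⟨_, h, Or.inr rfl⟩⟩
  · exact ⟨⟨_, h, Or.inr rfl⟩, ⟨_, h, Or.inl rfl⟩⟩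

/-- A factor of a relation word which is not a piece determines the relation word
and its position in it. -/
theorem eq_of_not_piece {p a₁ b₁ a₂ b₂ : List A} (hp : ¬ Piece R p)
    (h₁ : RelWord R (a₁ ++ p ++ b₁)) (h₂ : RelWord R (a₂ ++ p ++ b₂)) :
    a₁ = a₂ ∧ b₁ = b₂ := by
  by_contra hne
  refine hp (Or.inr ⟨_, _, a₁, b₁, a₂, b₂, h₁, h₂, rfl, rfl, ?_⟩)
  by_contra! h
  obtain ⟨h, rfl⟩ := h
  exact hne ⟨rfl, List.append_cancel_left h⟩

theorem WeaklyC.ne_nil {n : ℕ} (hC : WeaklyC R n) (hn : 0 < n) {x : List A}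
    (hx : RelWord R x) : x ≠ [] := by
  rintro rfl
  have := hC _ hx [] (by simp) rfl
  simp at this
  omega

theorem WeaklyC.not_piece {n : ℕ} (hC : WeaklyC R n) (hn : 1 < n) {x : List A}
    (hx : RelWord R x) : ¬ Piece R x := by
  intro hp
  have := hC _ hx [x] (by simpa using hp) (by simp)
  simp at this
  omega

theorem WeaklyC.not_piece_or_not_piece {n : ℕ} (hC : WeaklyC R n) (hn : 2 < n)
    {d f : List A} (hx : RelWord R (d ++ f)) : ¬ Piece R d ∨ ¬ Piece R f := by
  by_contra! hp
  have := hC _ hx [d, f] (by simpa using hp) (by simp)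
  simp at this
  omega

/-- A block is a word of length at most one or a factor of a relation word. -/
def Block (R : Finset (List A × List A)) (w : List A) : Prop :=
  w.length ≤ 1 ∨ ∃ p q, RelWord R (p ++ w ++ q)

theorem RelWord.block {x : List A} (hx : RelWord R x) : Block R x :=
  Or.inr ⟨[], [], by simpa using hx⟩

theorem Block.left {c d : List A} (h : Block R (c ++ d)) : Block R c := by
  rcases h with h | ⟨p, q, h⟩
  · left
    simp at h
    omega
  · exact Or.inr ⟨p, d ++ q, by simpa using h⟩

theorem Block.right {c d : List A} (h : Block R (c ++ d)) : Block R d := by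
  rcases h with h | ⟨p, q, h⟩
  · left
    simp at h
    omega
  · exact Or.inr ⟨p ++ c, q, by simpa using h⟩

theorem Block.context_eq_nil {a d c b e : List A} (h : Block R (c ++ d ++ e))
    (hx : RelWord R (a ++ d ++ b)) (hd : ¬ Piece R d) :
    c <:+ a ∧ e <+: b := by
  rcases h with h | ⟨p, q, h⟩
  · have : d ≠ [] := fun h0 => hd (Or.inl h0)
    have := List.length_pos_iff.2 this
    simp only [List.length_append] at h
    have hc : c = [] := List.length_eq_zero_iff.1 (by omega)
    have he : e = [] := List.length_eq_zero_iff.1 (by omega)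
    simp [hc, he]
  · obtain ⟨h₁, h₂⟩ := eq_of_not_piece (a₁ := p ++ c) (b₁ := e ++ q) hd (by simpa using h) hx
    exact ⟨⟨p, h₁⟩, ⟨q, h₂⟩⟩

/-- `w` is a product of at most `n` blocks. -/
def Covered (R : Finset (List A × List A)) (n : ℕ) (w : List A) : Prop :=
  ∃ L : List (List A), (∀ b ∈ L, Block R b) ∧ L.length ≤ n ∧ L.flatten = w

theorem covered_length (w : List A) : Covered R w.length w := by
  refine ⟨w.map fun a => [a], ?_, by simp, ?_⟩
  · simp [Block]
  · induction w <;> simp_all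

/-- A word is a concatenation of blocks cut at a boundary, or inside a block. -/
theorem flatten_split {L : List (List A)} {l r : List A} (h : L.flatten = l ++ r) :
    (∃ L₁ L₂, L = L₁ ++ L₂ ∧ l = L₁.flatten ∧ r = L₂.flatten) ∨
    ∃ L₁ c d L₂, L = L₁ ++ (c ++ d) :: L₂ ∧ l = L₁.flatten ++ c ∧ r = d ++ L₂.flatten := by
  rcases List.flatten_eq_append_iff.1 h with h | ⟨L₁, c, a, d, L₂, h⟩
  · exact Or.inl h
  · exact Or.inr ⟨L₁, c, a :: d, L₂, h⟩

theorem Covered.step (hC : WeaklyC R 3) {n : ℕ} {u v : List A} (hu : Covered R n u)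
    (h : OneStep R u v) : Covered R n v := by
  obtain ⟨l, r, x, y, hxy, rfl, rfl⟩ := h
  obtain ⟨hx, hy⟩ := RelWord.of_mem_or hxy
  have hx0 := hC.ne_nil (by norm_num) hx
  have hxp := hC.not_piece (by norm_num) hx
  have hyb := hy.block
  obtain ⟨L, hL, hn, hf⟩ := hu
  rw [List.append_assoc] at hf
  rcases flatten_split hf with ⟨L₁, L', rfl, rfl, hr⟩ | ⟨L₁, c, d, L', rfl, rfl, hr⟩
  · rcases flatten_split hr.symm with ⟨K, L₂, rfl, rfl, rfl⟩ | ⟨K, f, g, L₂, rfl, rfl, rfl⟩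
    · refine ⟨L₁ ++ y :: L₂, ?_, ?_, by simp⟩
      · grind
      · have : 0 < K.length := List.length_pos_iff.2 (by rintro rfl; simp at hx0)
        simp at hn ⊢
        omega
    · have hfg : Block R (f ++ g) := hL _ (by simp)
      rcases K with _ | ⟨k, K⟩
      · have hg : g = [] := by
          have := (Block.context_eq_nil (R := R) (a := []) (b := []) (c := []) (d := f)
            (e := g) (by simpa using hfg) (by simpa using hx) (by simpa using hxp)).2
          simpa using this
        subst hg
        exact ⟨L₁ ++ y :: L₂, by grind, by simpa using hn, by simp⟩
      · refine ⟨L₁ ++ y :: g :: L₂, ?_, ?_, by simp⟩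
        · have := hfg.right
          grind
        · simp at hn ⊢
          omega
  · have hcd : Block R (c ++ d) := hL _ (by simp)
    have hr' : (d :: L').flatten = x ++ r := by simp [hr]
    rcases flatten_split hr' with ⟨K, L₂, hK, rfl, rfl⟩ | ⟨K, f, g, L₂, hK, rfl, rfl⟩
    · rcases K with _ | ⟨k, K⟩
      · simp at hx0
      · obtain ⟨rfl, rfl⟩ : d = k ∧ L' = K ++ L₂ := by simpa using hK
        rcases K with _ | ⟨k, K⟩
        · have hc : c = [] := by
            have := (Block.context_eq_nil (R := R) (a := []) (b := []) (c := c) (d := d)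
              (e := []) (by simpa using hcd) (by simpa using hx) (by simpa using hxp)).1
            simpa using this
          subst hc
          exact ⟨L₁ ++ y :: L₂, by grind, by simpa using hn, by simp⟩
        · refine ⟨L₁ ++ c :: y :: L₂, ?_, ?_, by simp⟩
          · have := hcd.left
            grind
          · simp at hn ⊢
            omega
    · rcases K with _ | ⟨k, K⟩
      · obtain ⟨rfl, rfl⟩ : d = f ++ g ∧ L' = L₂ := by simpa using hK
        obtain ⟨hc, hg⟩ : c = [] ∧ g = [] := by
          have := Block.context_eq_nil (R := R) (a := []) (b := []) (c := c) (d := f)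
            (e := g) (by simpa using hcd) (by simpa using hx) (by simpa using hxp)
          simpa using this
        subst hc hg
        exact ⟨L₁ ++ y :: L', by grind, by simpa using hn, by simp⟩
      · obtain ⟨rfl, rfl⟩ : d = k ∧ L' = K ++ (f ++ g) :: L₂ := by simpa using hK
        have hfg : Block R (f ++ g) := hL _ (by simp)
        rcases K with _ | ⟨k, K⟩
        · simp at hx
          rcases hC.not_piece_or_not_piece (by norm_num) hx with hd | hf
          · have hc : c = [] := by
              have := (Block.context_eq_nil (R := R) (a := []) (b := f) (c := c) (d := d)
                (e := []) (by simpa using hcd) (by simpa using hx) hd).1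
              simpa using this
            subst hc
            refine ⟨L₁ ++ y :: g :: L₂, ?_, by simpa using hn, by simp⟩
            have := hfg.right
            grind
          · have hg : g = [] := by
              have := (Block.context_eq_nil (R := R) (a := d) (b := []) (c := []) (d := f)
                (e := g) (by simpa using hfg) (by simpa using hx) hf).2
              simpa using this
            subst hg
            refine ⟨L₁ ++ c :: y :: L₂, ?_, by simpa using hn, by simp⟩
            have := hcd.left
            grind
        · refine ⟨L₁ ++ c :: y :: g :: L₂, ?_, ?_, by simp⟩
          · have := hcd.left
            have := hfg.right
            grind
          · simp at hn ⊢
            omega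

theorem Covered.mEquiv (hC : WeaklyC R 3) {n : ℕ} {u v : List A} (hu : Covered R n u)
    (h : MEquiv R u v) : Covered R n v := by
  induction h with
  | refl => exact hu
  | tail _ h ih => exact ih.step hC h

theorem exists_length_le_of_block (R : Finset (List A × List A)) :
    ∃ M, ∀ w, Block R w → w.length ≤ M := by
  refine ⟨1 + ∑ p ∈ R, (p.1.length + p.2.length), fun w hw => ?_⟩
  rcases hw with hw | ⟨a, b, p, hp, h⟩
  · omega
  · have h₁ := Finset.single_le_sum (f := fun p : List A × List A => p.1.length + p.2.length)
      (fun _ _ => Nat.zero_le _) hp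
    have h₂ : (a ++ w ++ b).length ≤ p.1.length + p.2.length := by
      rcases h with h | h <;> rw [h] <;> omega
    simp only [List.length_append] at h₁ h₂
    omega

theorem Covered.length_le {M n : ℕ} (hM : ∀ w, Block R w → w.length ≤ M) {w : List A}
    (h : Covered R n w) : w.length ≤ n * M := by
  obtain ⟨L, hL, hn, rfl⟩ := h
  rw [List.length_flatten]
  calc (L.map List.length).sum ≤ (L.map List.length).length • M :=
        List.sum_le_card_nsmul _ _ (by simpa using fun b hb => hM b (hL b hb))
    _ ≤ n * M := by
        rw [List.length_map, smul_eq_mul]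
        exact Nat.mul_le_mul_right _ hn

theorem WeaklyC.mono {m n : ℕ} (hmn : m ≤ n) (hC : WeaklyC R n) : WeaklyC R m :=
  fun w hw L hL h => hmn.trans (hC w hw L hL h)

/-- In a weakly `C(3)` presentation, the length of a word is bounded linearly in the
length of any word equivalent to it. -/
theorem WeaklyC.exists_length_le (hC : WeaklyC R 3) :
    ∃ M, ∀ u v, MEquiv R u v → v.length ≤ u.length * M := by
  obtain ⟨M, hM⟩ := exists_length_le_of_block R
  exact ⟨M, fun u v h => ((covered_length u).mEquiv hC h).length_le hM⟩

end Covering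

section Reachability

variable {α : Type*}

/-- The elements reachable from `a` in at most `k` steps, given the list of successors
of every element. -/
def reachList (succs : α → List α) (a : α) (k : ℕ) : List α :=
  Nat.rec [a] (fun _ S => S ++ S.flatMap succs) k

theorem reachList_succ (succs : α → List α) (a : α) (k : ℕ) :
    reachList succs a (k + 1) = reachList succs a k ++ (reachList succs a k).flatMap succs :=
  rfl

theorem reflTransGen_of_mem_reachList {succs : α → List α} {a b : α} {k : ℕ}
    (h : b ∈ reachList succs a k) : Relation.ReflTransGen (fun x y => y ∈ succs x) a b := by
  induction k generalizing b with
  | zero =>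
    obtain rfl : b = a := by simpa [reachList] using h
    exact .refl
  | succ k ih =>
    rw [reachList_succ, List.mem_append, List.mem_flatMap] at h
    rcases h with h | ⟨c, hc, h⟩
    · exact ih h
    · exact (ih hc).tail h

theorem exists_mem_reachList {succs : α → List α} {a b : α}
    (h : Relation.ReflTransGen (fun x y => y ∈ succs x) a b) :
    ∃ k, b ∈ reachList succs a k := by
  induction h with
  | refl => exact ⟨0, by simp [reachList]⟩
  | tail _ h ih =>
    obtain ⟨k, hk⟩ := ih
    refine ⟨k + 1, ?_⟩
    rw [reachList_succ, List.mem_append, List.mem_flatMap]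
    exact Or.inr ⟨_, hk, h⟩

theorem mem_reachList_iff {succs : α → List α} {a b : α} {T : Finset α} {k : ℕ}
    (hT : ∀ c, Relation.ReflTransGen (fun x y => y ∈ succs x) a c → c ∈ T)
    (hk : T.card ≤ k) :
    b ∈ reachList succs a k ↔ Relation.ReflTransGen (fun x y => y ∈ succs x) a b := by
  classical
  refine ⟨reflTransGen_of_mem_reachList, fun h => ?_⟩
  set F : ℕ → Finset α := fun m => (reachList succs a m).toFinset with hF
  have hsucc : ∀ m, F (m + 1) = F m ∪ (F m).biUnion fun x => (succs x).toFinset := by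
    intro m
    ext x
    simp [hF, reachList_succ]
  have hmono : Monotone F := monotone_nat_of_le_succ fun m => by
    rw [hsucc]
    exact Finset.subset_union_left
  have hcard : ∀ m, T.card ≤ m → (F m).card = (F T.card).card := fun m hm =>
    Nat.stabilises_of_monotone (f := fun m => (F m).card)
      (fun i j hij => Finset.card_le_card (hmono hij))
      (fun m => Finset.card_le_card fun c hc =>
        hT c (reflTransGen_of_mem_reachList (by simpa [hF] using hc)))
      (fun m hm => by
        have := Finset.eq_of_subset_of_card_le (hmono m.le_succ) hm.ge
        change (F (m + 1)).card = (F (m + 1 + 1)).card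
        rw [hsucc (m + 1), ← Nat.succ_eq_add_one m, ← this, ← hsucc m]
        exact hm)
      hm
  obtain ⟨m, hm⟩ := exists_mem_reachList h
  have hk' : F k = F (max m k) := Finset.eq_of_subset_of_card_le (hmono (le_max_right _ _))
    (by rw [hcard k hk, hcard _ (hk.trans (le_max_right _ _))])
  have : b ∈ F (max m k) := hmono (le_max_left _ _) (by simpa [hF] using hm)
  rw [← hk'] at this
  simpa [hF] using this

theorem primrec_reachList {α : Type*} [Primcodable α] {succs : α → List α}
    (hs : Primrec succs) : Primrec₂ (reachList succs) :=
  (Primrec.nat_rec (f := fun a : α => [a])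
    (g := fun (_ : α) (p : ℕ × List α) => p.2 ++ p.2.flatMap succs)
    (Primrec.list_cons.comp .id (.const []))
    (Primrec.list_append.comp (Primrec.snd.comp .snd)
      (Primrec.list_flatMap (Primrec.snd.comp .snd) (hs.comp Primrec.snd).to₂)).to₂)

/-- Reachability is decidable when successors are computable and the number of elements
reachable from an element is computably bounded. -/
theorem primrecPred_reflTransGen {α : Type*} [Primcodable α]
    {succs : α → List α} (hs : Primrec succs) {K : α → ℕ} (hK : Primrec K)
    (hT : ∀ a, ∃ T : Finset α, T.card ≤ K a ∧
      ∀ c, Relation.ReflTransGen (fun x y => y ∈ succs x) a c → c ∈ T) :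
    PrimrecPred fun p : α × α => Relation.ReflTransGen (fun x y => y ∈ succs x) p.1 p.2 := by
  classical
  have h := (PrimrecRel.exists_mem_list (R := fun x y : α => x = y) Primrec.eq).comp
    ((primrec_reachList hs).comp Primrec.fst (hK.comp Primrec.fst)) (Primrec.snd (α := α))
  refine h.of_eq fun p => ?_
  obtain ⟨T, hcard, hT⟩ := hT p.1
  rw [← mem_reachList_iff hT hcard]
  simp

end Reachability

section Words

/-- An upper bound for the number of words of length at most `n` over `c` letters. -/
def wordBound (c n : ℕ) : ℕ :=
  Nat.rec 1 (fun _ k => 1 + c * k) n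

theorem primrec_wordBound (c : ℕ) : Primrec (wordBound c) :=
  Primrec.nat_rec₁ (f := fun _ k => 1 + c * k) 1
    (Primrec.nat_add.comp (.const 1) (Primrec.nat_mul.comp (.const c) .snd))

theorem exists_finset_length_le (A : Type*) [Fintype A] (n : ℕ) :
    ∃ T : Finset (List A), T.card ≤ wordBound (Fintype.card A) n ∧
      ∀ w : List A, w.length ≤ n → w ∈ T := by
  classical
  induction n with
  | zero => exact ⟨{[]}, by simp [wordBound], by simp⟩
  | succ n ih =>
    obtain ⟨T, hcard, hT⟩ := ih
    refine ⟨insert [] ((Finset.univ ×ˢ T).image fun p : A × List A => p.1 :: p.2), ?_, ?_⟩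
    · calc _ ≤ ((Finset.univ ×ˢ T).image fun p : A × List A => p.1 :: p.2).card + 1 :=
            Finset.card_insert_le _ _
        _ ≤ (Finset.univ ×ˢ T : Finset (A × List A)).card + 1 := by
            gcongr
            exact Finset.card_image_le
        _ ≤ 1 + Fintype.card A * wordBound (Fintype.card A) n := by
            rw [Finset.card_product, Finset.card_univ, add_comm]
            gcongr
    · rintro (_ | ⟨a, w⟩) hw
      · simp
      · have := hT w (by simpa using hw)
        simp [this]

/-- The results of replacing one occurrence of a left-hand side of a rule in `S` by the
right-hand side. -/
def rewrites {A : Type*} [DecidableEq A] (S : List (List A × List A)) (w : List A) :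
    List (List A) :=
  (List.range (w.length + 1)).flatMap fun i => S.flatMap fun p =>
    if (w.drop i).take p.1.length = p.1 then
      [w.take i ++ p.2 ++ w.drop (i + p.1.length)] else []

theorem mem_rewrites {A : Type*} [DecidableEq A] {S : List (List A × List A)}
    {w w' : List A} : w' ∈ rewrites S w ↔
      ∃ l r x y, (x, y) ∈ S ∧ w = l ++ x ++ r ∧ w' = l ++ y ++ r := by
  simp only [rewrites, List.mem_flatMap, List.mem_range]
  constructor
  · rintro ⟨i, hi, ⟨x, y⟩, hS, h⟩
    split_ifs at h with hx
    · refine ⟨w.take i, w.drop (i + x.length), x, y, hS, ?_, by simpa using h⟩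
      dsimp only at hx
      conv_lhs => rw [← List.take_append_drop i w, ← List.take_append_drop x.length (w.drop i),
        hx, List.drop_drop]
      simp
    · simp at h
  · rintro ⟨l, r, x, y, hS, rfl, rfl⟩
    refine ⟨l.length, by simp, (x, y), hS, ?_⟩
    simp

theorem primrec_rewrites {A : Type*} [Primcodable A] [DecidableEq A]
    (S : List (List A × List A)) : Primrec (rewrites S) := by
  have hw : Primrec fun q : (List A × ℕ) × (List A × List A) => q.1.1 :=
    Primrec.fst.comp .fst
  have hi : Primrec fun q : (List A × ℕ) × (List A × List A) => q.1.2 :=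
    Primrec.snd.comp .fst
  have hx : Primrec fun q : (List A × ℕ) × (List A × List A) => q.2.1 :=
    Primrec.fst.comp .snd
  have hy : Primrec fun q : (List A × ℕ) × (List A × List A) => q.2.2 :=
    Primrec.snd.comp .snd
  have hl := Primrec.list_length.comp hx
  refine Primrec.list_flatMap
    (Primrec.list_range.comp (Primrec.succ.comp Primrec.list_length)) ?_
  refine Primrec.list_flatMap (f := fun _ : List A × ℕ => S) (.const S) ?_
  exact Primrec.ite
    (Primrec.eq.comp (Primrec.list_take.comp hl (Primrec.list_drop.comp hi hw)) hx)
    (Primrec.list_cons.comp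
      (Primrec.list_append.comp
        (Primrec.list_append.comp (Primrec.list_take.comp hi hw) hy)
        (Primrec.list_drop.comp (Primrec.nat_add.comp hi hl) hw))
      (.const []))
    (.const [])

end Words

/-- Theorem 12, decidability form: for every weakly `C(4)` finite
monoid presentation, the word problem `{(u, v) : u ≡ v}` is decidable. -/
theorem wordProblem_decidable {A : Type} [Primcodable A] [Fintype A] [DecidableEq A]
    (R : Finset (List A × List A)) (hC : WeaklyC R 4) :
    ComputablePred fun uv : List A × List A => MEquiv R uv.1 uv.2 := by
  obtain ⟨M, hM⟩ := (hC.mono (by norm_num : 3 ≤ 4)).exists_length_le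
  set S : List (List A × List A) := R.toList ++ R.toList.map Prod.swap with hS
  have hstep : (fun u v => v ∈ rewrites S u) = OneStep R := by
    ext u v
    rw [mem_rewrites]
    simp [OneStep, hS]
  have h := primrecPred_reflTransGen (primrec_rewrites S)
    (K := fun u => wordBound (Fintype.card A) (u.length * M))
    ((primrec_wordBound _).comp (Primrec.nat_mul.comp Primrec.list_length (.const M)))
    (fun u => by
      obtain ⟨T, hcard, hT⟩ := exists_finset_length_le A (u.length * M)
      refine ⟨T, hcard, fun v hv => hT v (hM u v ?_)⟩
      rwa [hstep] at hv)
  rw [hstep] at h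
  obtain ⟨hdec, h⟩ := h
  exact ⟨hdec, h.to_comp⟩
end

section
/- For a weakly C(4) finite monoid presentation ⟨A | R⟩: every relation prefix of a word u admits a unique factorisation aXY with X and Y the maximal piece prefix and middle word of some relation word XYZ; that is, if a·X·Y = a′·X′·Y′ as words, where X, Y are the maximal piece prefix and middle word of a relation word XYZ and X′, Y′ are the maximal piece prefix and middle word of a relation word X′Y′Z′, then a = a′, X = X′ and Y = Y′. -/
open List

/-- In a weakly `C(3)` presentation, the product of the maximal piece prefix and the middle
word of a relation word is not a piece. -/
lemma RelDecomp.not_piece {A : Type*} {R : Finset (List A × List A)} (hC : WeaklyC R 3)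
    {X Y Z : List A} (hd : RelDecomp R X Y Z) : ¬ Piece R (X ++ Y) := by
  intro hp
  have h := hC _ hd.1 [X ++ Y, Z] (by simp [hp, hd.2.2.2.1]) (by simp)
  simp at h

/-- If `X' ++ Y'` is a suffix of `X ++ Y`, then both come from the same relation word, and the
suffix is not proper. -/
lemma RelDecomp.eq_of_append_eq {A : Type*} {R : Finset (List A × List A)} (hC : WeaklyC R 3)
    {X Y Z X' Y' Z' c : List A} (hd : RelDecomp R X Y Z) (hd' : RelDecomp R X' Y' Z')
    (h : X ++ Y = c ++ (X' ++ Y')) : c = [] ∧ X ++ Y ++ Z = X' ++ Y' ++ Z' := by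
  by_contra hne
  refine hd'.not_piece hC (Or.inr ⟨_, _, c, Z, [], Z', hd.1, hd'.1, by rw [h], by simp, ?_⟩)
  tauto

/-- A relation word determines its maximal piece prefix. -/
lemma MaxPiecePrefix.unique {A : Type*} {R : Finset (List A × List A)} {r X X' : List A}
    (hX : MaxPiecePrefix R r X) (hX' : MaxPiecePrefix R r X') : X = X' :=
  (List.prefix_of_prefix_length_le hX.1 hX'.1 (hX'.2.2 X hX.1 hX.2.1)).eq_of_length_le
    (hX.2.2 X' hX'.1 hX'.2.1)

/-- If `X' ++ Y'` is a suffix of `X ++ Y`, then the two factorisations coincide. -/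
lemma RelDecomp.unique_of_append_eq {A : Type*} {R : Finset (List A × List A)}
    (hC : WeaklyC R 3) {X Y Z X' Y' Z' c : List A} (hd : RelDecomp R X Y Z)
    (hd' : RelDecomp R X' Y' Z') (h : X ++ Y = c ++ (X' ++ Y')) :
    c = [] ∧ X = X' ∧ Y = Y' := by
  obtain ⟨rfl, hr⟩ := hd.eq_of_append_eq hC hd' h
  obtain rfl : X = X' := hd.2.1.unique (hr ▸ hd'.2.1)
  exact ⟨rfl, rfl, by simpa using h⟩

/-- for a weakly `C(4)` finite monoid presentation, every relation
prefix of a word `u` admits a unique factorisation `a ++ X ++ Y` with `X`, `Y` the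
maximal piece prefix and middle word of some relation word `X ++ Y ++ Z`. -/
theorem relPrefix_factorisation_unique {A : Type*} [Fintype A] [DecidableEq A]
    (R : Finset (List A × List A)) (hC : WeaklyC R 4)
    (u a X Y Z a' X' Y' Z' : List A)
    (hu : (a ++ X ++ Y) <+: u)
    (hd : RelDecomp R X Y Z) (hd' : RelDecomp R X' Y' Z')
    (heq : a ++ X ++ Y = a' ++ X' ++ Y') :
    a = a' ∧ X = X' ∧ Y = Y' := by
  have hC3 : WeaklyC R 3 := fun w hw L hL h => (by norm_num : 3 ≤ 4).trans (hC w hw L hL h)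
  rw [List.append_assoc, List.append_assoc, List.append_eq_append_iff] at heq
  obtain ⟨c, rfl, h⟩ | ⟨c, rfl, h⟩ := heq
  · obtain ⟨rfl, hX, hY⟩ := hd.unique_of_append_eq hC3 hd' h
    exact ⟨by simp, hX, hY⟩
  · obtain ⟨rfl, hX, hY⟩ := hd'.unique_of_append_eq hC3 hd h
    exact ⟨by simp, hX.symm, hY.symm⟩
end
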